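/- arXiv:2204.01401 — 4 statements merged into one kernel-verified Lean document; each statement's English description precedes it below -/
import Mathlib

section
/- For every t ≥ 0 and every pair of indices (k, ℓ) ∈ {1,…,N}², the sum over all binary sequences b restricted to the first t+1 coordinates satisfies Σ_{(b_0,…,b_t) ∈ {0,1}^{t+1}} T^b_t(k, ℓ) = 1. -/
open Finset

/-- The backward statistics `T^b_t` of the paper: `T^b_0(k,ℓ) = 1_{k ≠ ℓ}` if `b 0 = false`
and `1_{k = ℓ}` if `b 0 = true`; for `t ≥ 1`,
`T^b_t(k,ℓ) = 1_{k ≠ ℓ} ∑_{i,j} β_t(k,i) β_t(ℓ,j) T^b_{t-1}(i,j)` if `b t = false` and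
`T^b_t(k,ℓ) = 1_{k = ℓ} ∑_{i,j} β_t(k,i) W_{t-1}(j) T^b_{t-1}(i,j)` if `b t = true`. -/
noncomputable def backT {N : ℕ} (β : ℕ → Fin N → Fin N → ℝ) (W : ℕ → Fin N → ℝ)
    (b : ℕ → Bool) : ℕ → Fin N → Fin N → ℝ
  | 0, k, l => if b 0 then (if k = l then 1 else 0) else (if k ≠ l then 1 else 0)
  | t + 1, k, l =>
      if b (t + 1) then
        (if k = l then ∑ i, ∑ j, β (t + 1) k i * W t j * backT β W b t i j else 0)
      else
        (if k ≠ l then ∑ i, ∑ j, β (t + 1) k i * β (t + 1) l j * backT β W b t i j else 0)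

theorem backT_congr {N : ℕ} (β : ℕ → Fin N → Fin N → ℝ) (W : ℕ → Fin N → ℝ)
    (b c : ℕ → Bool) (t : ℕ) (h : ∀ s, s ≤ t → b s = c s) (k l : Fin N) :
    backT β W b t k l = backT β W c t k l := by
  induction t generalizing k l with
  | zero => simp only [backT, h 0 le_rfl]
  | succ t ih =>
    have ih' := ih (fun s hs => h s (by omega))
    simp only [backT, h (t + 1) le_rfl, ih']

theorem sum_weights {N M : ℕ} {ι : Type} [Fintype ι] (u : Fin N → ℝ) (v : Fin M → ℝ)
    (F : ι → Fin N → Fin M → ℝ) (hu : ∑ i, u i = 1) (hv : ∑ j, v j = 1)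
    (hF : ∀ i j, ∑ b, F b i j = 1) :
    ∑ b, ∑ i, ∑ j, u i * v j * F b i j = 1 := by
  rw [Finset.sum_comm]
  have : ∀ i, ∑ b, ∑ j, u i * v j * F b i j = u i := by
    intro i
    rw [Finset.sum_comm]
    simp only [← Finset.mul_sum, hF, mul_one, hv]
  simp only [this, hu]

/-- If the matrices `β_s` (for `s ≥ 1`) have nonnegative entries and rows
summing to one, and the weight vectors `W_s` are nonnegative and sum to one, then for every
`t ≥ 0` and every pair `(k, ℓ)`, the sum of `T^b_t(k, ℓ)` over all binary sequences `b`
restricted to the first `t + 1` coordinates equals `1`. -/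
theorem stmt3 {N : ℕ} (hN : 1 ≤ N) (β : ℕ → Fin N → Fin N → ℝ) (W : ℕ → Fin N → ℝ)
    (hβ_nonneg : ∀ s, 1 ≤ s → ∀ k i, 0 ≤ β s k i)
    (hβ_row : ∀ s, 1 ≤ s → ∀ k, ∑ i, β s k i = 1)
    (hW_nonneg : ∀ s j, 0 ≤ W s j) (hW_sum : ∀ s, ∑ j, W s j = 1)
    (t : ℕ) (k l : Fin N) :
    ∑ b : Fin (t + 1) → Bool,
        backT β W (fun s => if hs : s < t + 1 then b ⟨s, hs⟩ else false) t k l = 1 := by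
  induction t generalizing k l with
  | zero =>
    rw [← (Equiv.funUnique (Fin 1) Bool).symm.sum_comp]
    by_cases hkl : k = l <;> simp [backT, hkl, Equiv.funUnique]
  | succ t ih =>
    rw [← (Fin.snocEquiv (fun _ : Fin (t + 1 + 1) => Bool)).sum_comp, Fintype.sum_prod_type]
    have key : ∀ (x : Bool) (b : Fin (t + 1) → Bool) (i j : Fin N),
        backT β W (fun s => if hs : s < t + 1 + 1 then
          (Fin.snocEquiv (fun _ : Fin (t + 1 + 1) => Bool)) (x, b) ⟨s, hs⟩ else false) t i j
        = backT β W (fun s => if hs : s < t + 1 then b ⟨s, hs⟩ else false) t i j := by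
      intro x b i j
      apply backT_congr
      intro s hs
      have h1 : s < t + 1 := by omega
      have h2 : s < t + 1 + 1 := by omega
      simp [Fin.snocEquiv, Fin.snoc, h1, h2, hs]
    have last : ∀ (x : Bool) (b : Fin (t + 1) → Bool),
        (if hs : t + 1 < t + 1 + 1 then
          (Fin.snocEquiv (fun _ : Fin (t + 1 + 1) => Bool)) (x, b) ⟨t + 1, hs⟩ else false)
        = x := by
      intro x b
      simp [Fin.snocEquiv, Fin.snoc]
    simp only [backT, key, last, Fintype.sum_bool]
    have hb := hβ_row (t + 1) (by omega)
    by_cases hkl : k = l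
    · simpa [hkl] using sum_weights _ _ _ (hb l) (hW_sum t) ih
    · simpa [hkl] using sum_weights _ _ _ (hb k) (hb l) ih
end

section
/- For every t ≥ 0 and every pair of indices (k, ℓ) ∈ {1,…,N}², Σ_{(b_0,…,b_t) ∈ {0,1}^{t+1}} T̃^b_t(k, ℓ) = 1, regardless of the choice of the index maps J_s. -/
open Finset

/-- The PaRIS statistics `T̃^b_t` of the paper: `T̃^b_0(k,ℓ) = 1_{k ≠ ℓ}` if `b 0 = false`
and `1_{k = ℓ}` if `b 0 = true`; for `t ≥ 1`,
`T̃^b_t(k,ℓ) = 1_{k ≠ ℓ} M⁻¹ ∑_{i=1}^M T̃^b_{t-1}(J_t(k,i), J_t(ℓ,i))` if `b t = false` and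
`T̃^b_t(k,ℓ) = 1_{k = ℓ} M⁻¹ ∑_{i=1}^M ∑_{j=1}^N W_{t-1}(j) T̃^b_{t-1}(J_t(k,i), j)`
if `b t = true`. -/
noncomputable def parisT {N M : ℕ} (W : ℕ → Fin N → ℝ) (J : ℕ → Fin N → Fin M → Fin N)
    (b : ℕ → Bool) : ℕ → Fin N → Fin N → ℝ
  | 0, k, l => if b 0 then (if k = l then 1 else 0) else (if k ≠ l then 1 else 0)
  | t + 1, k, l =>
      if b (t + 1) then
        (if k = l then
          (M : ℝ)⁻¹ * ∑ i : Fin M, ∑ j : Fin N, W t j * parisT W J b t (J (t + 1) k i) j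
        else 0)
      else
        (if k ≠ l then
          (M : ℝ)⁻¹ * ∑ i : Fin M, parisT W J b t (J (t + 1) k i) (J (t + 1) l i)
        else 0)

theorem parisT_congr {N M : ℕ} (W : ℕ → Fin N → ℝ) (J : ℕ → Fin N → Fin M → Fin N)
    (b c : ℕ → Bool) (t : ℕ) (h : ∀ s, s ≤ t → b s = c s) (k l : Fin N) :
    parisT W J b t k l = parisT W J c t k l := by
  induction t generalizing k l with
  | zero => simp only [parisT, h 0 le_rfl]
  | succ t ih =>
    have ihc := ih (fun s hs => h s (by omega))
    simp only [parisT, h (t + 1) le_rfl, ihc]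

/-- If the weight vectors `W_s` are nonnegative and sum to one, then for
every `t ≥ 0` and every pair `(k, ℓ)`, the sum of the PaRIS statistics `T̃^b_t(k, ℓ)` over
all binary sequences `b` restricted to the first `t + 1` coordinates equals `1`, regardless
of the choice of the index maps `J_s`. -/
theorem stmt4 {N M : ℕ} (hN : 1 ≤ N) (hM : 1 ≤ M) (W : ℕ → Fin N → ℝ)
    (J : ℕ → Fin N → Fin M → Fin N)
    (hW_nonneg : ∀ s j, 0 ≤ W s j) (hW_sum : ∀ s, ∑ j, W s j = 1)
    (t : ℕ) (k l : Fin N) :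
    ∑ b : Fin (t + 1) → Bool,
        parisT W J (fun s => if hs : s < t + 1 then b ⟨s, hs⟩ else false) t k l = 1 := by
  have hMne : (M : ℝ) ≠ 0 := by
    have : M ≠ 0 := by omega
    exact_mod_cast this
  induction t generalizing k l with
  | zero =>
    rw [← (Equiv.funUnique (Fin 1) Bool).symm.sum_comp]
    by_cases h : k = l <;> simp [parisT, h]
  | succ t ih =>
    rw [← (Fin.snocEquiv (fun _ : Fin (t + 2) => Bool)).sum_comp, Fintype.sum_prod_type]
    have key : ∀ (x : Bool) (b : Fin (t + 1) → Bool) (k l : Fin N),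
        parisT W J (fun s => if hs : s < t + 1 + 1 then
          (Fin.snocEquiv (fun _ : Fin (t + 2) => Bool)) (x, b) ⟨s, hs⟩ else false) t k l =
        parisT W J (fun s => if hs : s < t + 1 then b ⟨s, hs⟩ else false) t k l := by
      intro x b k l
      apply parisT_congr
      intro s hs
      have h1 : s < t + 1 := by omega
      have h2 : s < t + 1 + 1 := by omega
      simp [hs, h1, h2, Fin.snocEquiv, Fin.snoc]
    have hlast : ∀ (x : Bool) (b : Fin (t + 1) → Bool),
        (if hs : t + 1 < t + 1 + 1 then
          (Fin.snocEquiv (fun _ : Fin (t + 2) => Bool)) (x, b) ⟨t + 1, hs⟩ else false) = x := by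
      intro x b
      simp [Fin.snocEquiv, Fin.snoc]
    simp only [parisT, key, hlast]
    by_cases h : k = l
    · simp only [Fintype.sum_bool, h, if_true, ne_eq, not_true_eq_false, if_false,
        Bool.false_eq_true, Finset.sum_const_zero, add_zero]
      rw [← Finset.mul_sum, Finset.sum_comm]
      have : ∀ i : Fin M, ∑ b : Fin (t + 1) → Bool, ∑ j : Fin N, W t j *
          parisT W J (fun s => if hs : s < t + 1 then b ⟨s, hs⟩ else false) t
            (J (t + 1) l i) j = 1 := by
        intro i
        rw [Finset.sum_comm]
        simp only [← Finset.mul_sum, ih, mul_one, hW_sum]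
      simp only [this]; simp [hMne]
    · simp only [Fintype.sum_bool, h, if_true, ne_eq, not_false_eq_true, if_false,
        Bool.false_eq_true, Finset.sum_const_zero, zero_add]
      rw [← Finset.mul_sum, Finset.sum_comm]
      simp only [ih]; simp [hMne]
end

section
/- For every t ≥ 0 and every vector a : {1,…,N} → ℝ, Σ_{(b_0,…,b_t) ∈ {0,1}^{t+1}} Σ_{k,ℓ=1}^N T^b_t(k, ℓ) a(k) a(ℓ) = (Σ_{k=1}^N a(k))². -/
open Finset

theorem backT_sum_one {N : ℕ} (β : ℕ → Fin N → Fin N → ℝ) (W : ℕ → Fin N → ℝ)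
    (hβ_row : ∀ s, 1 ≤ s → ∀ k, ∑ i, β s k i = 1)
    (hW_sum : ∀ s, ∑ j, W s j = 1) (t : ℕ) (k l : Fin N) :
    ∑ b : Fin (t + 1) → Bool,
        backT β W (fun s => if hs : s < t + 1 then b ⟨s, hs⟩ else false) t k l = 1 := by
  induction t generalizing k l with
  | zero =>
    rw [← (Equiv.funUnique (Fin 1) Bool).symm.sum_comp]
    by_cases hkl : k = l <;> simp [backT, hkl]
  | succ t ih =>
    rw [← (Fin.snocEquiv (fun _ : Fin (t + 2) => Bool)).sum_comp, Fintype.sum_prod_type,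
      Fintype.sum_bool]
    have key : ∀ (x : Bool) (b : Fin (t + 1) → Bool) (i j : Fin N),
        backT β W (fun s => if hs : s < t + 1 + 1 then
          (Fin.snocEquiv (fun _ : Fin (t + 2) => Bool)) (x, b) ⟨s, hs⟩ else false) t i j
        = backT β W (fun s => if hs : s < t + 1 then b ⟨s, hs⟩ else false) t i j := by
      intro x b i j
      apply backT_congr
      intro s hs
      have h1 : s < t + 1 := by omega
      have h2 : s < t + 1 + 1 := by omega
      simp [hs, h1, h2, Fin.snocEquiv, Fin.snoc]
    have top : ∀ (x : Bool) (b : Fin (t + 1) → Bool) (h : t + 1 < t + 1 + 1),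
        (Fin.snocEquiv (fun _ : Fin (t + 2) => Bool)) (x, b) ⟨t + 1, h⟩ = x := by
      intro x b h
      simp [Fin.snocEquiv, Fin.snoc]
    have gen : ∀ f : Fin N → Fin N → ℝ, ∑ b : Fin (t + 1) → Bool, ∑ i, ∑ j, f i j *
        backT β W (fun s => if hs : s < t + 1 then b ⟨s, hs⟩ else false) t i j
        = ∑ i, ∑ j, f i j := by
      intro f
      rw [Finset.sum_comm]
      refine Finset.sum_congr rfl fun i _ => ?_
      rw [Finset.sum_comm]
      refine Finset.sum_congr rfl fun j _ => ?_
      rw [← Finset.mul_sum, ih, mul_one]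
    simp only [backT, key, top, Nat.lt_succ_self, dite_true]
    by_cases hkl : k = l
    · simp only [hkl, if_true, ne_eq, not_true, if_false, Bool.false_eq_true,
        Finset.sum_const_zero, add_zero]
      rw [gen]
      simp only [← Finset.mul_sum, hW_sum, mul_one, hβ_row (t + 1) (by omega)]
    · simp only [hkl, if_true, ne_eq, not_false_eq_true, if_false, Bool.false_eq_true,
        Finset.sum_const_zero, zero_add]
      rw [gen]
      simp only [← Finset.mul_sum, mul_one, hβ_row (t + 1) (by omega)]

/-- Under the row-stochasticity assumptions on `β_s` and `W_s`, for every
`t ≥ 0` and every vector `a : {1,…,N} → ℝ`,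
`∑_{b ∈ {0,1}^{t+1}} ∑_{k,ℓ} T^b_t(k,ℓ) a(k) a(ℓ) = (∑_k a(k))²`. -/
theorem stmt5 {N : ℕ} (hN : 1 ≤ N) (β : ℕ → Fin N → Fin N → ℝ) (W : ℕ → Fin N → ℝ)
    (hβ_nonneg : ∀ s, 1 ≤ s → ∀ k i, 0 ≤ β s k i)
    (hβ_row : ∀ s, 1 ≤ s → ∀ k, ∑ i, β s k i = 1)
    (hW_nonneg : ∀ s j, 0 ≤ W s j) (hW_sum : ∀ s, ∑ j, W s j = 1)
    (t : ℕ) (a : Fin N → ℝ) :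
    ∑ b : Fin (t + 1) → Bool, ∑ k, ∑ l,
        backT β W (fun s => if hs : s < t + 1 then b ⟨s, hs⟩ else false) t k l * a k * a l
      = (∑ k, a k) ^ 2 := by
  rw [Finset.sum_comm, sq, Finset.sum_mul_sum]
  refine Finset.sum_congr rfl fun k _ => ?_
  rw [Finset.sum_comm]
  refine Finset.sum_congr rfl fun l _ => ?_
  rw [← Finset.sum_mul, ← Finset.sum_mul, backT_sum_one β W hβ_row hW_sum, one_mul]
end

section
/- Let N ≥ 2 and let h : X × X → ℝ be a measurable function with |h(x, y)| ≤ B for all x, y and some constant B ≥ 0. Then ∫_{X^N} ( (N(N−1))^{−1} Σ_{i ≠ j} h(x_i, x_j) − (χ ⊗ χ)(h) )² dχ^{⊗N}(x_1, …, x_N) ≤ 4B² (4N(N−1)(N−2) + 2N(N−1)) / (N²(N−1)²); in particular the L² error of this estimator of (χ ⊗ χ)(h) is O(N^{−1/2}). -/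
open MeasureTheory Finset

open ProbabilityTheory

lemma law_pair {X : Type*} [MeasurableSpace X] (χ : Measure X) [IsProbabilityMeasure χ]
    (N : ℕ) (i j : Fin N) (hij : i ≠ j) :
    (Measure.pi fun _ : Fin N => χ).map (fun x => (x i, x j)) = χ.prod χ := by
  have hind : iIndepFun (fun (i : Fin N) (x : Fin N → X) => x i)
      (Measure.pi fun _ : Fin N => χ) :=
    iIndepFun_pi (X := fun _ => id) (fun _ => aemeasurable_id)
  have h1 := hind.indepFun hij
  rw [indepFun_iff_map_prod_eq_prod_map_map (measurable_pi_apply i).aemeasurable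
    (measurable_pi_apply j).aemeasurable] at h1
  rw [h1, (measurePreserving_eval (fun _ : Fin N => χ) i).map_eq,
    (measurePreserving_eval (fun _ : Fin N => χ) j).map_eq]

lemma cross_zero {X : Type*} [MeasurableSpace X] (χ : Measure X) [IsProbabilityMeasure χ]
    (N : ℕ) (g : X × X → ℝ) (hg : Measurable g) (h0 : ∫ p, g p ∂(χ.prod χ) = 0)
    (i j k l : Fin N) (hij : i ≠ j) (hik : i ≠ k) (hil : i ≠ l) (hjk : j ≠ k) (hjl : j ≠ l) :
    ∫ x : Fin N → X, g (x i, x j) * g (x k, x l) ∂(Measure.pi fun _ : Fin N => χ) = 0 := by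
  have hind : iIndepFun (fun (i : Fin N) (x : Fin N → X) => x i)
      (Measure.pi fun _ : Fin N => χ) :=
    iIndepFun_pi (X := fun _ => id) (fun _ => aemeasurable_id)
  have h1 := hind.indepFun_prodMk_prodMk (fun _ => by fun_prop) i j k l hik hil hjk hjl
  have h2 := h1.comp hg hg
  have h3 := h2.integral_fun_mul_eq_mul_integral
    (by exact Measurable.aestronglyMeasurable (by fun_prop))
    (by exact Measurable.aestronglyMeasurable (by fun_prop))
  simp only [Function.comp_def] at h3
  rw [h3]
  have h4 : ∫ x : Fin N → X, g (x i, x j) ∂(Measure.pi fun _ : Fin N => χ) = 0 := by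
    rw [← h0, ← law_pair χ N i j hij, integral_map (by fun_prop) hg.aestronglyMeasurable]
  rw [h4, zero_mul]

lemma count_disj (N : ℕ) (hN : 2 ≤ N) (p : Fin N × Fin N) (hp : p.1 ≠ p.2) :
    ((((univ : Finset (Fin N)) \ {p.1, p.2}).offDiag).card : ℝ)
      = ((N : ℝ) - 2) * ((N : ℝ) - 3) := by
  have hc : ((univ : Finset (Fin N)) \ {p.1, p.2}).card = N - 2 := by
    rw [card_sdiff_of_subset (subset_univ _), card_pair hp, card_univ, Fintype.card_fin]
  rw [offDiag_card, hc]
  obtain ⟨M, rfl⟩ := Nat.exists_eq_add_of_le hN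
  have : 2 + M - 2 = M := by omega
  rw [this, Nat.cast_sub (Nat.le_mul_self M)]
  push_cast; ring

lemma sum_bound {X : Type*} [MeasurableSpace X] (χ : Measure X) [IsProbabilityMeasure χ]
    (N : ℕ) (hN : 2 ≤ N) (g : X × X → ℝ) (hg : Measurable g)
    (h0 : ∫ p, g p ∂(χ.prod χ) = 0) (C : ℝ) (hC : ∀ p, |g p| ≤ C) :
    ∫ x : Fin N → X, (∑ p ∈ (univ : Finset (Fin N)).offDiag, g (x p.1, x p.2)) ^ 2
        ∂(Measure.pi fun _ : Fin N => χ)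
      ≤ (N : ℝ) * ((N : ℝ) - 1) * (4 * (N : ℝ) - 6) * C ^ 2 := by
  have hb : ∀ (p q : Fin N × Fin N) (x : Fin N → X),
      ‖g (x p.1, x p.2) * g (x q.1, x q.2)‖ ≤ C ^ 2 := by
    intro p q x
    rw [norm_mul, sq]
    exact mul_le_mul (hC _) (hC _) (norm_nonneg _) ((abs_nonneg _).trans (hC (x p.1, x p.2)))
  have hint : ∀ (p q : Fin N × Fin N), Integrable
      (fun x : Fin N → X => g (x p.1, x p.2) * g (x q.1, x q.2))
      (Measure.pi fun _ : Fin N => χ) := by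
    intro p q
    exact Integrable.of_bound (Measurable.aestronglyMeasurable (by fun_prop)) (C ^ 2)
      (ae_of_all _ (hb p q))
  have hcS : (((univ : Finset (Fin N)).offDiag).card : ℝ) = (N : ℝ) * ((N : ℝ) - 1) := by
    rw [offDiag_card, card_univ, Fintype.card_fin, Nat.cast_sub (Nat.le_mul_self N)]
    push_cast; ring
  simp_rw [sq (∑ p ∈ _, _), sum_mul_sum]
  rw [integral_finsetSum _ (fun p _ => integrable_finsetSum _ (fun q _ => hint p q))]
  rw [← hcS, mul_assoc, ← nsmul_eq_mul]
  apply sum_le_card_nsmul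
  intro p hp
  have hp' : p.1 ≠ p.2 := by simpa using hp
  rw [integral_finsetSum _ (fun q _ => hint p q)]
  have hsub : ((univ : Finset (Fin N)) \ {p.1, p.2}).offDiag ⊆ (univ : Finset (Fin N)).offDiag :=
    offDiag_mono (subset_univ _)
  rw [← sum_sdiff hsub]
  have hz : ∑ q ∈ ((univ : Finset (Fin N)) \ {p.1, p.2}).offDiag,
      ∫ x : Fin N → X, g (x p.1, x p.2) * g (x q.1, x q.2)
        ∂(Measure.pi fun _ : Fin N => χ) = 0 := by
    apply sum_eq_zero
    intro q hq
    simp only [mem_offDiag, mem_sdiff, mem_univ, true_and, mem_insert, mem_singleton,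
      not_or] at hq
    obtain ⟨⟨a, b⟩, ⟨c, d⟩, e⟩ := hq
    exact cross_zero χ N g hg h0 _ _ _ _ hp' (Ne.symm a) (Ne.symm c) (Ne.symm b) (Ne.symm d)
  rw [hz, add_zero]
  have hcard : (((univ : Finset (Fin N)).offDiag \
      ((univ : Finset (Fin N)) \ {p.1, p.2}).offDiag).card : ℝ) = 4 * (N : ℝ) - 6 := by
    rw [cast_card_sdiff hsub, hcS, count_disj N hN p hp']
    ring
  rw [← hcard, ← nsmul_eq_mul]
  apply sum_le_card_nsmul
  intro q _
  have := norm_integral_le_of_norm_le_const (μ := Measure.pi fun _ : Fin N => χ)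
    (ae_of_all _ (hb p q))
  simp only [probReal_univ, mul_one] at this
  exact (le_abs_self _).trans this

/-- Let `χ` be a probability measure on `X`, `N ≥ 2`, and
`h : X × X → ℝ` measurable with `|h| ≤ B` for a constant `B ≥ 0`. Then on `X^N` with the
product measure `χ^{⊗N}`,
`∫ ((N(N-1))⁻¹ ∑_{i ≠ j} h(x_i, x_j) - (χ ⊗ χ)(h))² dχ^{⊗N}
  ≤ 4B² (4N(N-1)(N-2) + 2N(N-1)) / (N²(N-1)²)`;
in particular the L² error of this estimator of `(χ ⊗ χ)(h)` is `O(N^{-1/2})`. -/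
theorem stmt13 {X : Type*} [MeasurableSpace X] (χ : Measure X) [IsProbabilityMeasure χ]
    (N : ℕ) (hN : 2 ≤ N) (h : X × X → ℝ) (hh : Measurable h)
    (B : ℝ) (hB0 : 0 ≤ B) (hB : ∀ x y, |h (x, y)| ≤ B) :
    ∫ x : Fin N → X,
        (((N : ℝ) * ((N : ℝ) - 1))⁻¹ *
            (∑ i, ∑ j, (if i ≠ j then h (x i, x j) else 0)) -
          ∫ y, ∫ z, h (y, z) ∂χ ∂χ) ^ 2
        ∂(Measure.pi fun _ : Fin N => χ)
      ≤ 4 * B ^ 2 *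
          (4 * (N : ℝ) * ((N : ℝ) - 1) * ((N : ℝ) - 2) + 2 * (N : ℝ) * ((N : ℝ) - 1)) /
          ((N : ℝ) ^ 2 * ((N : ℝ) - 1) ^ 2) := by
  have hbd : ∀ p : X × X, ‖h p‖ ≤ B := fun p => hB p.1 p.2
  have hi : Integrable h (χ.prod χ) :=
    Integrable.of_bound hh.aestronglyMeasurable B (ae_of_all _ hbd)
  rw [← integral_prod h hi]
  set m := ∫ p, h p ∂(χ.prod χ) with hm
  have hmB : |m| ≤ B := by
    have := norm_integral_le_of_norm_le_const (μ := χ.prod χ) (ae_of_all _ hbd)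
    simpa using this
  have key := sum_bound χ N hN (fun p => h p - m) (hh.sub_const m)
    (by rw [integral_sub hi (integrable_const _)]; simp [hm]) (2 * B)
    (fun p => by
      have h1 := abs_sub (h p) m
      have h2 := hbd p
      rw [Real.norm_eq_abs] at h2
      linarith)
  have hN' : (2 : ℝ) ≤ N := by exact_mod_cast hN
  have hA : (0 : ℝ) < (N : ℝ) * ((N : ℝ) - 1) := by nlinarith
  have hcS : (((univ : Finset (Fin N)).offDiag).card : ℝ) = (N : ℝ) * ((N : ℝ) - 1) := by
    rw [offDiag_card, card_univ, Fintype.card_fin, Nat.cast_sub (Nat.le_mul_self N)]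
    push_cast; ring
  have heq : ∀ x : Fin N → X, (((N : ℝ) * ((N : ℝ) - 1))⁻¹ *
            (∑ i, ∑ j, (if i ≠ j then h (x i, x j) else 0)) - m) ^ 2
      = (((N : ℝ) * ((N : ℝ) - 1))⁻¹) ^ 2 *
        (∑ p ∈ (univ : Finset (Fin N)).offDiag, (h (x p.1, x p.2) - m)) ^ 2 := by
    intro x
    have e1 : ∑ i, ∑ j, (if i ≠ j then h (x i, x j) else 0)
        = ∑ p ∈ (univ : Finset (Fin N)).offDiag, h (x p.1, x p.2) := by
      rw [← Fintype.sum_prod_type' (fun i j => if i ≠ j then h (x i, x j) else 0),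
        ← sum_filter]
      congr 1
      ext p; simp
    rw [e1, sum_sub_distrib, sum_const, nsmul_eq_mul, hcS, ← mul_pow,
      mul_sub (((N : ℝ) * ((N : ℝ) - 1))⁻¹),
      inv_mul_cancel_left₀ hA.ne']
  simp_rw [heq]
  rw [integral_const_mul]
  refine (mul_le_mul_of_nonneg_left key (by positivity)).trans (le_of_eq ?_)
  have a : (N : ℝ) ≠ 0 := by linarith
  have b : (N : ℝ) - 1 ≠ 0 := by linarith
  field_simp
  ring
end
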